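/- (Analogue of Stafford's theorem) (1) Every finitely generated left ideal of I₁ is generated by two elements. (2a) Every left ideal of I₁ that is not contained in F is generated by two elements. (2b) Every finitely generated left ideal of I₁ contained in F is generated by a single element. The same statements hold for right ideals. -/

import Mathlib

open Polynomial

noncomputable section
set_option synthInstance.maxHeartbeats 1000000
set_option maxHeartbeats 1000000
set_option linter.unusedSectionVars false

variable (K : Type*) [Field K] [CharZero K]

/-- The derivative operator `∂ = d/dx` on `K[x]`. -/
def derOp : Module.End K (Polynomial K) := Polynomial.derivative

/-- The multiplication-by-`x` operator on `K[x]`. -/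
def xOp : Module.End K (Polynomial K) := LinearMap.mulLeft K Polynomial.X

/-- The integration operator `∫`, determined by `∫ xⁿ = xⁿ⁺¹/(n+1)`. -/
def intOp : Module.End K (Polynomial K) :=
  (Polynomial.basisMonomials K).constr K fun n => ((n : K) + 1)⁻¹ • X ^ (n + 1)

/-- The algebra `I₁` of polynomial integro-differential operators: the subalgebra of
`End_K(K[x])` generated by `x`, `∂` and `∫`. -/
def I1 : Subalgebra K (Module.End K (Polynomial K)) :=
  Algebra.adjoin K {xOp K, derOp K, intOp K}

/-- `e_{ij} := ∫^i ∂^j − ∫^{i+1} ∂^{j+1}`. -/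
def eOp (i j : ℕ) : Module.End K (Polynomial K) :=
  intOp K ^ i * derOp K ^ j - intOp K ^ (i + 1) * derOp K ^ (j + 1)

/-- `F`, the `K`-linear span of the `e_{ij}`; it is the (two-sided) ideal of compact
operators of `I₁`. -/
def Fset : Submodule K (Module.End K (Polynomial K)) :=
  Submodule.span K {f | ∃ i j, f = eOp K i j}

lemma xOp_mem : xOp K ∈ I1 K := Algebra.subset_adjoin (by simp)
lemma derOp_mem : derOp K ∈ I1 K := Algebra.subset_adjoin (by simp)
lemma intOp_mem : intOp K ∈ I1 K := Algebra.subset_adjoin (by simp)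

lemma eOp_mem (i j : ℕ) : eOp K i j ∈ I1 K :=
  sub_mem (mul_mem (pow_mem (intOp_mem K) i) (pow_mem (derOp_mem K) j))
    (mul_mem (pow_mem (intOp_mem K) (i + 1)) (pow_mem (derOp_mem K) (j + 1)))

/-- `e_{ij}` as an element of the ring `I₁`. -/
def eI (i j : ℕ) : I1 K := ⟨eOp K i j, eOp_mem K i j⟩

/-- `∂` as an element of the ring `I₁`. -/
def derI : I1 K := ⟨derOp K, derOp_mem K⟩

/-- `∫` as an element of the ring `I₁`. -/
def intI : I1 K := ⟨intOp K, intOp_mem K⟩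

/-- `H := ∂ ∘ x` (first multiply by `x`, then differentiate). -/
def hOp : Module.End K (Polynomial K) := derOp K * xOp K

/-- `K[H]`, the unital subalgebra of `I₁` generated by `H`. -/
def KH : Subalgebra K (Module.End K (Polynomial K)) := Algebra.adjoin K {hOp K}

/-- The action of `a ∈ I₁` on a left `I₁`-module `M`, as a `K`-linear map `a_M : M → M`. -/
def actMap (a : I1 K) (M : Type*) [AddCommGroup M] [Module (I1 K) M] [Module K M]
    [SMulCommClass K (I1 K) M] : M →ₗ[K] M where
  toFun m := a • m
  map_add' := smul_add a
  map_smul' k m := (smul_comm k a m).symm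

/-- Right multiplication `b ↦ b * a` in a ring `R`, as a homomorphism of left `R`-modules. -/
def rmulMap (R : Type*) [Ring R] (a : R) : R →ₗ[R] R where
  toFun b := b * a
  map_add' b c := add_mul b c a
  map_smul' c b := by simp [smul_eq_mul, mul_assoc]

/-- Left multiplication `b ↦ a * b` in a ring `R`, as a homomorphism of right `R`-modules
(i.e. of left `Rᵐᵒᵖ`-modules). -/
def lmulMap (R : Type*) [Ring R] (a : R) : R →ₗ[Rᵐᵒᵖ] R where
  toFun b := a * b
  map_add' b c := mul_add a b c
  map_smul' c b := by simp [MulOpposite.smul_eq_mul_unop, mul_assoc]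

/-- The centralizer `Cen_{I₁}(a) = {b ∈ I₁ : ab = ba}` of `a` in `I₁`, as a subalgebra of
`End_K(K[x])`. -/
def Cen (a : Module.End K (Polynomial K)) : Subalgebra K (Module.End K (Polynomial K)) :=
  I1 K ⊓ Subalgebra.centralizer K {a}

/-- `Cen_F(a) = {f ∈ F : af = fa}`, a `K`-subspace of `End_K(K[x])`. -/
def CenF (a : Module.End K (Polynomial K)) : Submodule K (Module.End K (Polynomial K)) :=
  Fset K ⊓ Subalgebra.toSubmodule (Subalgebra.centralizer K {a})

/-- The rank one operator `q ↦ (coefficient of xʲ in q) • p`. -/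
def rankOne (j : ℕ) (p : K[X]) : Module.End K K[X] := (lcoeff K j).smulRight p

variable {K}

lemma rankOne_apply (j : ℕ) (p q : K[X]) : rankOne K j p q = q.coeff j • p := rfl

lemma rankOne_add (j : ℕ) (p q : K[X]) :
    rankOne K j (p + q) = rankOne K j p + rankOne K j q :=
  LinearMap.ext fun r => by simp [rankOne_apply]

lemma rankOne_smul (j : ℕ) (c : K) (p : K[X]) :
    rankOne K j (c • p) = c • rankOne K j p :=
  LinearMap.ext fun q => by simp only [rankOne_apply, LinearMap.smul_apply, smul_comm c]

lemma mul_rankOne (a : Module.End K K[X]) (j : ℕ) (p : K[X]) :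
    a * rankOne K j p = rankOne K j (a p) := by
  refine LinearMap.ext fun q => ?_
  simp [rankOne_apply, Module.End.mul_apply]

lemma end_ext {a b : Module.End K K[X]} (h : ∀ n, a (X ^ n) = b (X ^ n)) : a = b := by
  refine (Polynomial.basisMonomials K).ext fun n => ?_
  simpa [← X_pow_eq_monomial] using h n

lemma intOp_X_pow (n : ℕ) : intOp K (X ^ n) = ((n : K) + 1)⁻¹ • X ^ (n + 1) := by
  have := (Polynomial.basisMonomials K).constr_basis K
    (fun n : ℕ => (((n : K) + 1)⁻¹ • X ^ (n + 1) : K[X])) n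
  simpa [intOp, ← X_pow_eq_monomial] using this

lemma derOp_apply (p : K[X]) : derOp K p = derivative p := rfl

lemma xOp_apply (p : K[X]) : xOp K p = X * p := rfl

lemma derOp_pow_apply (j : ℕ) (p : K[X]) : (derOp K ^ j) p = derivative^[j] p := by
  rw [Module.End.pow_apply]; rfl

lemma xOp_pow_apply (j : ℕ) (p : K[X]) : (xOp K ^ j) p = X ^ j * p := by
  induction j with
  | zero => simp
  | succ j ih => rw [pow_succ', Module.End.mul_apply, ih, xOp_apply]; ring

lemma derOp_mul_intOp : derOp K * intOp K = 1 := by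
  refine end_ext fun n => ?_
  have : (n : K) + 1 ≠ 0 := by exact_mod_cast n.succ_ne_zero
  rw [Module.End.mul_apply, intOp_X_pow, map_smul, derOp_apply, derivative_X_pow,
    ← smul_eq_C_mul, smul_smul]
  simp [this]

lemma derOp_mul_xOp : derOp K * xOp K = xOp K * derOp K + 1 := by
  refine LinearMap.ext fun p => ?_
  simp [Module.End.mul_apply, derOp_apply, xOp_apply, add_comm]

lemma intOp_mul_derOp : intOp K * derOp K = 1 - rankOne K 0 1 := by
  refine end_ext fun n => ?_
  rw [Module.End.mul_apply, derOp_apply, derivative_X_pow, ← smul_eq_C_mul, map_smul, intOp_X_pow]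
  rcases n with _ | n
  · simp [rankOne_apply]
  · have : (n : K) + 1 ≠ 0 := by exact_mod_cast n.succ_ne_zero
    simp [rankOne_apply, smul_smul, this, coeff_X_pow]

lemma rankOne_mul_derOp_pow (j : ℕ) (p : K[X]) :
    rankOne K 0 p * derOp K ^ j = (j.factorial : K) • rankOne K j p := by
  refine LinearMap.ext fun q => ?_
  simp only [Module.End.mul_apply, derOp_pow_apply, rankOne_apply, coeff_iterate_derivative,
    zero_add, Nat.descFactorial_self, LinearMap.smul_apply, smul_smul]
  simp [nsmul_eq_mul]

lemma intOp_pow_one (i : ℕ) : (intOp K ^ i) 1 = (i.factorial : K)⁻¹ • X ^ i := by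
  induction i with
  | zero => simp
  | succ i ih =>
    rw [pow_succ', Module.End.mul_apply, ih, map_smul, intOp_X_pow, smul_smul,
      Nat.factorial_succ]
    push_cast
    rw [mul_inv_rev]

lemma eOp_eq (i j : ℕ) :
    eOp K i j = (j.factorial * (i.factorial : K)⁻¹) • rankOne K j (X ^ i) := by
  have : eOp K i j = intOp K ^ i * (1 - intOp K * derOp K) * derOp K ^ j := by
    rw [eOp, pow_succ, pow_succ']; simp only [mul_sub, sub_mul, mul_one, mul_assoc]
  rw [this, intOp_mul_derOp, sub_sub_cancel, mul_rankOne, rankOne_mul_derOp_pow, intOp_pow_one,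
    rankOne_smul, smul_smul]

lemma rankOne_mem_Fset (j : ℕ) (p : K[X]) : rankOne K j p ∈ Fset K := by
  induction p using Polynomial.induction_on' with
  | add p q hp hq => rw [rankOne_add]; exact add_mem hp hq
  | monomial n c =>
    have h : rankOne K j (X ^ n) = ((n.factorial : K) * (j.factorial : K)⁻¹) • eOp K n j := by
      have h1 : (n.factorial : K) ≠ 0 := by exact_mod_cast n.factorial_ne_zero
      have h2 : (j.factorial : K) ≠ 0 := by exact_mod_cast j.factorial_ne_zero
      rw [eOp_eq, smul_smul]
      field_simp
      simp
    rw [← C_mul_X_pow_eq_monomial, ← smul_eq_C_mul, rankOne_smul, h]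
    exact Submodule.smul_mem _ _ (Submodule.smul_mem _ _ (Submodule.subset_span ⟨n, j, rfl⟩))

lemma Fset_induction {p : (f : Module.End K K[X]) → f ∈ Fset K → Prop}
    (rank : ∀ j q, p (rankOne K j q) (rankOne_mem_Fset j q)) (zero : p 0 (zero_mem _))
    (add : ∀ f g hf hg, p f hf → p g hg → p (f + g) (add_mem hf hg)) {f : Module.End K K[X]}
    (hf : f ∈ Fset K) : p f hf := by
  have : Fset K = Submodule.span K {f | ∃ j q, f = rankOne K j q} := by
    refine le_antisymm (Submodule.span_le.2 ?_) (Submodule.span_le.2 ?_)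
    · rintro _ ⟨i, j, rfl⟩
      rw [eOp_eq, ← rankOne_smul]
      exact Submodule.subset_span ⟨_, _, rfl⟩
    · rintro _ ⟨j, q, rfl⟩
      exact rankOne_mem_Fset j q
  suffices ∃ h, p f h from this.2
  rw [this] at hf
  refine Submodule.closure_induction (p := fun f _ => ∃ h, p f h) ⟨_, zero⟩
    (fun f g _ _ hf hg => ⟨_, add f g hf.1 hg.1 hf.2 hg.2⟩) ?_ hf
  rintro c _ ⟨j, q, rfl⟩
  rw [← rankOne_smul]
  exact ⟨_, rank _ _⟩

lemma Fset_mem_I1 {f : Module.End K K[X]} (hf : f ∈ Fset K) : f ∈ I1 K := by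
  have : Fset K ≤ Subalgebra.toSubmodule (I1 K) := by
    refine Submodule.span_le.2 ?_
    rintro _ ⟨i, j, rfl⟩
    exact eOp_mem K i j
  exact this hf

lemma mul_mem_Fset (a : Module.End K K[X]) {f : Module.End K K[X]} (hf : f ∈ Fset K) :
    a * f ∈ Fset K := by
  induction hf using Fset_induction with
  | rank j q => rw [mul_rankOne]; exact rankOne_mem_Fset _ _
  | zero => simp
  | add f g _ _ hf hg => rw [mul_add]; exact add_mem hf hg

lemma coeff_intOp_zero (p : K[X]) : (intOp K p).coeff 0 = 0 := by
  have : (lcoeff K 0) ∘ₗ intOp K = 0 := by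
    refine (Polynomial.basisMonomials K).ext fun n => ?_
    simp [← X_pow_eq_monomial, intOp_X_pow]
  exact LinearMap.congr_fun this p

lemma coeff_intOp_succ (p : K[X]) (j : ℕ) :
    (intOp K p).coeff (j + 1) = ((j : K) + 1)⁻¹ * p.coeff j := by
  have : (lcoeff K (j + 1)) ∘ₗ intOp K = ((j : K) + 1)⁻¹ • lcoeff K j := by
    refine (Polynomial.basisMonomials K).ext fun n => ?_
    simp only [coe_basisMonomials, ← X_pow_eq_monomial, LinearMap.comp_apply, intOp_X_pow,
      lcoeff_apply, coeff_smul, coeff_X_pow, LinearMap.smul_apply, smul_eq_mul]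
    by_cases h : j = n <;> simp [h]
  exact LinearMap.congr_fun this p

lemma smul_one_mem_I1 (c : K) : c • (1 : Module.End K K[X]) ∈ I1 K :=
  Subalgebra.smul_mem _ (one_mem _) c

lemma I1_induction {p : (a : Module.End K K[X]) → a ∈ I1 K → Prop}
    (smul : ∀ c : K, p (c • 1) (smul_one_mem_I1 c))
    (x : p (xOp K) (xOp_mem K)) (der : p (derOp K) (derOp_mem K)) (int : p (intOp K) (intOp_mem K))
    (add : ∀ a b ha hb, p a ha → p b hb → p (a + b) (add_mem ha hb))
    (mul : ∀ a b ha hb, p a ha → p b hb → p (a * b) (mul_mem ha hb))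
    {a : Module.End K K[X]} (ha : a ∈ I1 K) : p a ha := by
  refine Algebra.adjoin_induction (p := p) ?_
    (fun c => by simpa only [Algebra.algebraMap_eq_smul_one] using smul c) add mul ha
  rintro _ (rfl | rfl | rfl) <;> assumption

lemma Fset_mul_mem {f r : Module.End K K[X]} (hf : f ∈ Fset K) (hr : r ∈ I1 K) :
    f * r ∈ Fset K := by
  have key : ∀ r : Module.End K K[X], (∀ j q, rankOne K j q * r ∈ Fset K) →
      ∀ f ∈ Fset K, f * r ∈ Fset K := by
    intro r hr f hf
    induction hf using Fset_induction with
    | rank j q => exact hr j q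
    | zero => simp
    | add f g _ _ hf hg => rw [add_mul]; exact add_mem hf hg
  revert f
  suffices ∀ f ∈ Fset K, f * r ∈ Fset K from fun {f} => this f
  induction hr using I1_induction with
  | smul c => intro f hf; simpa using Submodule.smul_mem _ _ hf
  | add a b _ _ ha hb => intro f hf; rw [mul_add]; exact add_mem (ha f hf) (hb f hf)
  | mul a b _ _ ha hb => intro f hf; rw [← mul_assoc]; exact hb _ (ha f hf)
  | x =>
    refine key _ fun j q => ?_
    rcases j with _ | j
    · convert zero_mem (Fset K)
      refine LinearMap.ext fun p => ?_
      simp [rankOne_apply, xOp_apply, Module.End.mul_apply]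
    · convert rankOne_mem_Fset j q using 1
      refine LinearMap.ext fun p => ?_
      simp [rankOne_apply, xOp_apply, Module.End.mul_apply]
  | der =>
    refine key _ fun j q => ?_
    convert Submodule.smul_mem _ ((j : K) + 1) (rankOne_mem_Fset (j + 1) q) using 1
    refine LinearMap.ext fun p => ?_
    simp [rankOne_apply, derOp_apply, Module.End.mul_apply, coeff_derivative, smul_smul, mul_comm]
  | int =>
    refine key _ fun j q => ?_
    rcases j with _ | j
    · convert zero_mem (Fset K)
      refine LinearMap.ext fun p => ?_
      simp [rankOne_apply, coeff_intOp_zero, Module.End.mul_apply]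
    · convert Submodule.smul_mem _ ((j : K) + 1)⁻¹ (rankOne_mem_Fset j q) using 1
      refine LinearMap.ext fun p => ?_
      simp [rankOne_apply, coeff_intOp_succ, Module.End.mul_apply, smul_smul]

lemma exists_coeff_eq_zero_of_mem_Fset {f : Module.End K K[X]} (hf : f ∈ Fset K) :
    ∃ s, ∀ p, ∀ j ≥ s, (f p).coeff j = 0 := by
  induction hf using Fset_induction with
  | rank j q =>
    refine ⟨q.natDegree + 1, fun p j hj => ?_⟩
    rw [rankOne_apply, coeff_smul, coeff_eq_zero_of_natDegree_lt (p := q) (by omega), smul_zero]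
  | zero => exact ⟨0, by simp⟩
  | add f g _ _ hf hg =>
    obtain ⟨s, hs⟩ := hf
    obtain ⟨t, ht⟩ := hg
    exact ⟨s + t, fun p j hj => by simp [hs p j (by omega), ht p j (by omega)]⟩

lemma one_sub_mem_Fset (k : ℕ) : 1 - intOp K ^ k * derOp K ^ k ∈ Fset K := by
  have h := Finset.sum_range_sub' (fun i => intOp K ^ i * derOp K ^ i) k
  rw [pow_zero, pow_zero, one_mul] at h
  rw [← h]
  exact sum_mem fun i _ => Submodule.subset_span ⟨i, i, rfl⟩

variable (K) in
/-- The Bernstein filtration of the Weyl algebra: the span of `xⁱ∂ʲ` with `i + j ≤ n`. -/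
def weylFil (n : ℕ) : Submodule K (Module.End K K[X]) :=
  Submodule.span K {a | ∃ i j, i + j ≤ n ∧ a = xOp K ^ i * derOp K ^ j}

lemma mem_weylFil {i j n : ℕ} (h : i + j ≤ n) : xOp K ^ i * derOp K ^ j ∈ weylFil K n :=
  Submodule.subset_span ⟨i, j, h, rfl⟩

lemma weylFil_mono : Monotone (weylFil K) := fun _ _ h =>
  Submodule.span_mono fun _ ⟨i, j, hij, ha⟩ => ⟨i, j, hij.trans h, ha⟩

lemma one_mem_weylFil (n : ℕ) : 1 ∈ weylFil K n := by
  simpa using mem_weylFil (K := K) (i := 0) (j := 0) (Nat.zero_le n)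

/-- A linear map sends a filtration step into a subspace as soon as it does so on generators. -/
lemma weylFil_map_le {M : Type*} [AddCommGroup M] [Module K M] {n : ℕ} {P : Submodule K M}
    (f : Module.End K K[X] →ₗ[K] M)
    (h : ∀ i j, i + j ≤ n → f (xOp K ^ i * derOp K ^ j) ∈ P) {a : Module.End K K[X]}
    (ha : a ∈ weylFil K n) : f a ∈ P := by
  have : weylFil K n ≤ P.comap f := by
    refine Submodule.span_le.2 ?_
    rintro _ ⟨i, j, hij, rfl⟩
    exact h i j hij
  exact this ha

lemma derOp_mul_xOp_pow (i : ℕ) :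
    derOp K * xOp K ^ (i + 1) = xOp K ^ (i + 1) * derOp K + ((i : K) + 1) • xOp K ^ i := by
  refine LinearMap.ext fun p => ?_
  simp [Module.End.mul_apply, derOp_apply, xOp_pow_apply, smul_eq_C_mul]
  ring

lemma derOp_pow_mul_xOp (j : ℕ) :
    derOp K ^ (j + 1) * xOp K = xOp K * derOp K ^ (j + 1) + ((j : K) + 1) • derOp K ^ j := by
  induction j with
  | zero => simp [derOp_mul_xOp]
  | succ j ih =>
    rw [pow_succ', mul_assoc, ih, mul_add, ← mul_assoc, derOp_mul_xOp, mul_smul_comm, ← pow_succ',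
      add_mul, one_mul, mul_assoc, ← pow_succ']
    push_cast
    module

lemma xOp_mul_mem_weylFil {n : ℕ} {a : Module.End K K[X]} (ha : a ∈ weylFil K n) :
    xOp K * a ∈ weylFil K (n + 1) :=
  weylFil_map_le (LinearMap.mulLeft K (xOp K)) (fun i j h => by
    rw [LinearMap.mulLeft_apply, ← mul_assoc, ← pow_succ']
    exact mem_weylFil (by omega)) ha

lemma derOp_mul_mem_weylFil {n : ℕ} {a : Module.End K K[X]} (ha : a ∈ weylFil K n) :
    derOp K * a ∈ weylFil K (n + 1) :=
  weylFil_map_le (LinearMap.mulLeft K (derOp K)) (fun i j h => by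
    rw [LinearMap.mulLeft_apply, ← mul_assoc]
    rcases i with _ | i
    · rw [pow_zero, mul_one, ← pow_succ', ← one_mul (derOp K ^ _), ← pow_zero (xOp K)]
      exact mem_weylFil (by omega)
    · rw [derOp_mul_xOp_pow, add_mul, mul_assoc, ← pow_succ', smul_mul_assoc]
      exact add_mem (mem_weylFil (by omega)) (Submodule.smul_mem _ _ (mem_weylFil (by omega)))) ha

lemma derOp_commutator_mem_weylFil {n : ℕ} {a : Module.End K K[X]} (ha : a ∈ weylFil K (n + 1)) :
    derOp K * a - a * derOp K ∈ weylFil K n :=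
  weylFil_map_le (LinearMap.mulLeft K (derOp K) - LinearMap.mulRight K (derOp K)) (fun i j h => by
    rw [LinearMap.sub_apply, LinearMap.mulLeft_apply, LinearMap.mulRight_apply, ← mul_assoc]
    rcases i with _ | i
    · rw [pow_zero, mul_one, one_mul, ← pow_succ', ← pow_succ, sub_self]
      exact zero_mem _
    · rw [derOp_mul_xOp_pow, add_mul, mul_assoc, mul_assoc, ← pow_succ', ← pow_succ,
        add_sub_cancel_left, smul_mul_assoc]
      exact Submodule.smul_mem _ _ (mem_weylFil (by omega))) ha

lemma xOp_commutator_mem_weylFil {n : ℕ} {a : Module.End K K[X]} (ha : a ∈ weylFil K (n + 1)) :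
    a * xOp K - xOp K * a ∈ weylFil K n :=
  weylFil_map_le (LinearMap.mulRight K (xOp K) - LinearMap.mulLeft K (xOp K)) (fun i j h => by
    rw [LinearMap.sub_apply, LinearMap.mulLeft_apply, LinearMap.mulRight_apply, ← mul_assoc,
      mul_assoc]
    rcases j with _ | j
    · rw [pow_zero, mul_one, one_mul, ← pow_succ', ← pow_succ, sub_self]
      exact zero_mem _
    · rw [derOp_pow_mul_xOp, mul_add, ← mul_assoc, ← pow_succ', ← pow_succ,
        add_sub_cancel_left, mul_smul_comm]
      exact Submodule.smul_mem _ _ (mem_weylFil (by omega))) ha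

lemma mul_mem_weylFil {m n : ℕ} {a b : Module.End K K[X]} (ha : a ∈ weylFil K m)
    (hb : b ∈ weylFil K n) : a * b ∈ weylFil K (m + n) := by
  have hx : ∀ (i n : ℕ) (b : Module.End K K[X]), b ∈ weylFil K n →
      xOp K ^ i * b ∈ weylFil K (n + i) := by
    intro i
    induction i with
    | zero => intro n b hb; simpa using hb
    | succ i ih =>
      intro n b hb
      rw [pow_succ', mul_assoc]
      exact xOp_mul_mem_weylFil (ih n b hb)
  have hd : ∀ (j n : ℕ) (b : Module.End K K[X]), b ∈ weylFil K n →
      derOp K ^ j * b ∈ weylFil K (n + j) := by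
    intro j
    induction j with
    | zero => intro n b hb; simpa using hb
    | succ j ih =>
      intro n b hb
      rw [pow_succ', mul_assoc]
      exact derOp_mul_mem_weylFil (ih n b hb)
  refine weylFil_map_le (LinearMap.mulRight K b) (fun i j h => ?_) ha
  rw [LinearMap.mulRight_apply, mul_assoc]
  exact weylFil_mono (by omega) (hx i _ _ (hd j _ _ hb))

lemma weylFil_le_I1 {n : ℕ} {a : Module.End K K[X]} (ha : a ∈ weylFil K n) : a ∈ I1 K :=
  weylFil_map_le (P := Subalgebra.toSubmodule (I1 K)) LinearMap.id
    (fun i j _ => (I1 K).mul_mem (pow_mem (xOp_mem K) i) (pow_mem (derOp_mem K) j)) ha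

open scoped Classical in
lemma weylFil_succ_le (n : ℕ) :
    weylFil K (n + 1) ≤ weylFil K n ⊔ Submodule.span K
      (((Finset.range (n + 2)).image fun i => xOp K ^ i * derOp K ^ (n + 1 - i) :) :
        Set (Module.End K K[X])) := by
  refine Submodule.span_le.2 ?_
  rintro _ ⟨i, j, h, rfl⟩
  rcases h.lt_or_eq with h | h
  · exact Submodule.mem_sup_left (mem_weylFil (by omega))
  · refine Submodule.mem_sup_right (Submodule.subset_span ?_)
    rw [Finset.mem_coe, Finset.mem_image]
    exact ⟨i, Finset.mem_range.2 (by omega), by rw [show n + 1 - i = j by omega]⟩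

instance weylFil_finiteDimensional (n : ℕ) : FiniteDimensional K (weylFil K n) := by
  refine FiniteDimensional.span_of_finite K ?_
  refine ((Set.finite_Iic n).prod (Set.finite_Iic n) |>.image
    fun ij : ℕ × ℕ => xOp K ^ ij.1 * derOp K ^ ij.2).subset ?_
  rintro _ ⟨i, j, h, rfl⟩
  exact ⟨(i, j), ⟨by simp; omega, by simp; omega⟩, rfl⟩

open scoped Classical in
lemma finrank_weylFil_succ_le (n : ℕ) :
    Module.finrank K (weylFil K (n + 1)) ≤ Module.finrank K (weylFil K n) + (n + 2) := by
  refine (Submodule.finrank_mono (weylFil_succ_le n)).trans <|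
    (Submodule.finrank_add_le_finrank_add_finrank _ _).trans ?_
  refine Nat.add_le_add_left ?_ _
  exact (finrank_span_finset_le_card _).trans (Finset.card_image_le.trans (by simp))

lemma finrank_weylFil_add_le (n d : ℕ) :
    Module.finrank K (weylFil K (n + d)) ≤
      Module.finrank K (weylFil K n) + d * (n + d + 1) := by
  induction d with
  | zero => simp
  | succ d ih =>
    have := finrank_weylFil_succ_le (K := K) (n + d)
    rw [← add_assoc]
    nlinarith

lemma exists_derOp_pow_mul_mem_weylFil {r : Module.End K K[X]} (hr : r ∈ I1 K) :
    ∃ k n, derOp K ^ k * r ∈ weylFil K n := by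
  have mul_add : ∀ (k l n : ℕ) (a : Module.End K K[X]), derOp K ^ k * a ∈ weylFil K n →
      ∃ m, derOp K ^ (l + k) * a ∈ weylFil K m := by
    intro k l n a h
    refine ⟨l + n, ?_⟩
    rw [pow_add, mul_assoc]
    refine mul_mem_weylFil ?_ h
    simpa using mem_weylFil (K := K) (i := 0) (j := l) le_rfl
  have of_add : ∀ a b : Module.End K K[X], (∃ k n, derOp K ^ k * a ∈ weylFil K n) →
      (∃ k n, derOp K ^ k * b ∈ weylFil K n) → ∃ k n, derOp K ^ k * (a + b) ∈ weylFil K n := by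
    rintro a b ⟨k, n, h⟩ ⟨l, m, h'⟩
    obtain ⟨n', hn⟩ := mul_add k l n a h
    obtain ⟨m', hm⟩ := mul_add l k m b h'
    refine ⟨l + k, n' + m', ?_⟩
    rw [_root_.mul_add]
    rw [add_comm k l] at hm
    exact add_mem (weylFil_mono (by omega) hn) (weylFil_mono (by omega) hm)
  suffices ∀ a : Module.End K K[X], (∃ k n, derOp K ^ k * a ∈ weylFil K n) →
      ∃ k n, derOp K ^ k * (r * a) ∈ weylFil K n by
    simpa using this 1 ⟨0, 0, by simpa using one_mem_weylFil 0⟩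
  induction hr using I1_induction with
  | smul c =>
    rintro a ⟨k, n, h⟩
    exact ⟨k, n, by simpa using Submodule.smul_mem _ c h⟩
  | add r s _ _ hr hs =>
    intro a h
    rw [add_mul]
    exact of_add _ _ (hr a h) (hs a h)
  | mul r s _ _ hr hs =>
    intro a h
    rw [mul_assoc]
    exact hr _ (hs a h)
  | x =>
    rintro a ⟨k, n, h⟩
    obtain ⟨m, hm⟩ := mul_add k 1 n a h
    refine ⟨k + 1, n + m + 1, ?_⟩
    rw [← mul_assoc, derOp_pow_mul_xOp, add_mul, mul_assoc, smul_mul_assoc]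
    rw [add_comm 1 k] at hm
    exact add_mem (weylFil_mono (by omega) (xOp_mul_mem_weylFil hm))
      (Submodule.smul_mem _ _ (weylFil_mono (by omega) h))
  | der =>
    rintro a ⟨k, n, h⟩
    refine ⟨k, n + 1, ?_⟩
    rw [← mul_assoc, ← pow_succ, pow_succ', mul_assoc]
    exact derOp_mul_mem_weylFil h
  | int =>
    rintro a ⟨k, n, h⟩
    refine ⟨k + 1, n, ?_⟩
    rwa [← mul_assoc, pow_succ, mul_assoc (derOp K ^ k), derOp_mul_intOp, mul_one]

lemma exists_eval_ne_zero {p : K[X]} (hp : p ≠ 0) :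
    ∃ N : ℕ, ∀ n : ℕ, N ≤ n → p.eval (n : K) ≠ 0 := by
  have hfin : {n : ℕ | p.IsRoot (n : K)}.Finite :=
    (Polynomial.finite_setOfPred_isRoot hp).preimage Nat.cast_injective.injOn
  obtain ⟨N, hN⟩ := hfin.bddAbove
  exact ⟨N + 1, fun n hn h => by have := hN h; omega⟩

/-- Matrix entries of elements of the Weyl algebra are polynomial along each diagonal. -/
lemma exists_diagonals {n : ℕ} {b : Module.End K K[X]} (hb : b ∈ weylFil K n) :
    ∃ c : ℤ →₀ K[X], ∀ k m : ℕ, (b (X ^ k)).coeff m = (c (m - k)).eval (k : K) := by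
  refine Submodule.span_induction (p := fun b _ => ∃ c : ℤ →₀ K[X],
    ∀ k m : ℕ, (b (X ^ k)).coeff m = (c (m - k)).eval (k : K)) ?_ ⟨0, by simp⟩ ?_ ?_ hb
  · rintro _ ⟨i, j, -, rfl⟩
    refine ⟨Finsupp.single ((i : ℤ) - j) (descPochhammer K j), fun k m => ?_⟩
    rw [Module.End.mul_apply, derOp_pow_apply, xOp_pow_apply, iterate_derivative_X_pow_eq_smul,
      mul_smul_comm, ← pow_add, coeff_smul, coeff_X_pow, Finsupp.single_apply]
    rcases lt_or_ge k j with h | h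
    · rw [Nat.descFactorial_eq_zero_iff_lt.2 h]
      split_ifs <;>
        simp [descPochhammer_eval_eq_descFactorial, Nat.descFactorial_eq_zero_iff_lt.2 h]
    · by_cases hm : m = i + (k - j)
      · rw [if_pos hm, if_pos (by omega), descPochhammer_eval_eq_descFactorial]
        simp
      · rw [if_neg hm, if_neg (by omega)]
        simp
  · rintro a b _ _ ⟨c, hc⟩ ⟨d, hd⟩
    exact ⟨c + d, fun k m => by simp [hc, hd]⟩
  · rintro r a _ ⟨c, hc⟩
    exact ⟨r • c, fun k m => by simp [hc]⟩

lemma diagonals_ne_zero {b : Module.End K K[X]} (hb : b ≠ 0) {c : ℤ →₀ K[X]}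
    (hc : ∀ k m : ℕ, (b (X ^ k)).coeff m = (c (m - k)).eval (k : K)) : c.support.Nonempty := by
  rw [Finsupp.support_nonempty_iff]
  rintro rfl
  exact hb (end_ext fun k => by ext m; simp [hc])

/-- The highest nonzero diagonal of a nonzero element of the Weyl algebra. -/
lemma exists_top_diagonal {n : ℕ} {b : Module.End K K[X]} (hb : b ∈ weylFil K n) (h0 : b ≠ 0) :
    ∃ (t : ℤ) (N : ℕ), (∀ k m : ℕ, t < m - k → (b (X ^ k)).coeff m = 0) ∧
      ∀ k m : ℕ, N ≤ k → (m : ℤ) = k + t → (b (X ^ k)).coeff m ≠ 0 := by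
  obtain ⟨c, hc⟩ := exists_diagonals hb
  have hs := diagonals_ne_zero h0 hc
  obtain ⟨N, hN⟩ := exists_eval_ne_zero (Finsupp.mem_support_iff.1 (c.support.max'_mem hs))
  refine ⟨c.support.max' hs, N, fun k m h => ?_, fun k m h hm => ?_⟩
  · rw [hc, Finsupp.notMem_support_iff.1 fun h' => ?_, eval_zero]
    exact absurd (c.support.le_max' _ h') (by omega)
  · rw [hc, show (m : ℤ) - k = c.support.max' hs by omega]
    exact hN k h

/-- The lowest nonzero diagonal of a nonzero element of the Weyl algebra. -/
lemma exists_bot_diagonal {n : ℕ} {b : Module.End K K[X]} (hb : b ∈ weylFil K n) (h0 : b ≠ 0) :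
    ∃ (t : ℤ) (N : ℕ), (∀ k m : ℕ, (m : ℤ) - k < t → (b (X ^ k)).coeff m = 0) ∧
      ∀ k m : ℕ, N ≤ k → (m : ℤ) = k + t → (b (X ^ k)).coeff m ≠ 0 := by
  obtain ⟨c, hc⟩ := exists_diagonals hb
  have hs := diagonals_ne_zero h0 hc
  obtain ⟨N, hN⟩ := exists_eval_ne_zero (Finsupp.mem_support_iff.1 (c.support.min'_mem hs))
  refine ⟨c.support.min' hs, N, fun k m h => ?_, fun k m h hm => ?_⟩
  · rw [hc, Finsupp.notMem_support_iff.1 fun h' => ?_, eval_zero]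
    exact absurd (c.support.min'_le _ h') (by omega)
  · rw [hc, show (m : ℤ) - k = c.support.min' hs by omega]
    exact hN k h

lemma apply_eq_sum (u : Module.End K K[X]) (q : K[X]) (m : ℕ) :
    (u q).coeff m = ∑ k ∈ q.support, q.coeff k * (u (X ^ k)).coeff m := by
  conv_lhs => rw [q.as_sum_support]
  simp [← C_mul_X_pow_eq_monomial, ← smul_eq_C_mul]

lemma weylFil_mul_ne_zero {m n : ℕ} {u b : Module.End K K[X]} (hu : u ∈ weylFil K m)
    (hb : b ∈ weylFil K n) (hu0 : u ≠ 0) (hb0 : b ≠ 0) : u * b ≠ 0 := by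
  obtain ⟨t, N, ht, hN⟩ := exists_top_diagonal hb hb0
  obtain ⟨s, M, hs, hM⟩ := exists_top_diagonal hu hu0
  intro h
  obtain ⟨k, l, r, hk, hl, hr, hMl⟩ :
      ∃ k l r : ℕ, N ≤ k ∧ (l : ℤ) = k + t ∧ (r : ℤ) = l + s ∧ M ≤ l :=
    ⟨N + M + t.natAbs + s.natAbs, (N + M + t.natAbs + s.natAbs + t).toNat,
      (N + M + t.natAbs + s.natAbs + t + s).toNat, by omega, by omega, by omega, by omega⟩
  have h1 : ((u * b) (X ^ k)).coeff r = 0 := by simp [h]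
  rw [Module.End.mul_apply, apply_eq_sum, Finset.sum_eq_single l] at h1
  · exact mul_ne_zero (hN k l hk hl) (hM l r hMl hr) h1
  · intro i hi hil
    rcases lt_or_gt_of_ne hil with h2 | h2
    · rw [hs i r (by omega), mul_zero]
    · exact absurd (ht k i (by omega)) (mem_support_iff.1 hi)
  · intro hl'
    exact absurd (notMem_support_iff.1 hl') (hN k l hk hl)

/-- The Weyl relation has no nonzero finite-dimensional representation. -/
lemma finrank_eq_zero_of_weyl_relation {V : Type*} [AddCommGroup V] [Module K V]
    [FiniteDimensional K V] (D Y : Module.End K V) (h : D * Y - Y * D = 1) :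
    Module.finrank K V = 0 := by
  have := congrArg (LinearMap.trace K V) h
  rw [map_sub, LinearMap.trace_mul_comm, sub_self, LinearMap.trace_one] at this
  exact_mod_cast this.symm

/-- The growth of a filtered module over the Weyl algebra is at least linear. -/
lemma finrank_filtration_gt {M : Type*} [AddCommGroup M] [Module K M] (D Y : Module.End K M)
    (h : D * Y - Y * D = 1) (V : ℕ → Submodule K M) [∀ n, FiniteDimensional K (V n)]
    (hV : ∀ n, V n ≤ V (n + 1)) (hD : ∀ n, ∀ v ∈ V n, D v ∈ V (n + 1))
    (hY : ∀ n, ∀ v ∈ V n, Y v ∈ V (n + 1)) (h0 : V 0 ≠ ⊥) (n : ℕ) :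
    n < Module.finrank K (V n) := by
  have hne : ∀ n, V n ≠ ⊥ := fun n =>
    ne_bot_of_le_ne_bot h0 (monotone_nat_of_le_succ hV (Nat.zero_le n))
  induction n with
  | zero => exact Nat.pos_of_ne_zero fun h => h0 (Submodule.finrank_eq_zero.1 h)
  | succ n ih =>
    refine (Nat.succ_le_of_lt ih).trans_lt (Submodule.finrank_lt_finrank_of_lt ?_)
    refine lt_of_le_of_ne (hV n) fun heq => hne n (Submodule.finrank_eq_zero.1 ?_)
    refine finrank_eq_zero_of_weyl_relation
      (D.restrict fun v hv => heq.symm ▸ hD n v hv) (Y.restrict fun v hv => heq.symm ▸ hY n v hv) ?_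
    ext v
    exact LinearMap.congr_fun h (v : M)

lemma finrank_inf_weylFil_add_le_aux {M : Type*} [AddCommGroup M] [Module K M]
    {P Q : Submodule K (Module.End K K[X])} (hPQ : P ≤ Q) (π : Module.End K K[X] →ₗ[K] M)
    (hπ : LinearMap.ker π = P) (hsurj : Function.Surjective π) (D Y : Module.End K M)
    (hD : ∀ a, D (π a) = π (derOp K * a)) (hY : ∀ a, Y (π a) = π (xOp K * a))
    (hQ : ∀ r ∈ I1 K, ∀ a ∈ Q, r * a ∈ Q)
    {m : ℕ} {v : Module.End K K[X]} (hvm : v ∈ weylFil K m) (hvQ : v ∈ Q) (hvP : v ∉ P) (n : ℕ) :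
    Module.finrank K (P ⊓ weylFil K (n + m) : Submodule K (Module.End K K[X])) + (n + 1) ≤
      Module.finrank K (Q ⊓ weylFil K (n + m) : Submodule K (Module.End K K[X])) := by
  set φ : Module.End K K[X] →ₗ[K] M := π ∘ₗ LinearMap.mulRight K v with hφ
  have hgrow : n < Module.finrank K ((weylFil K n).map φ) := by
    refine finrank_filtration_gt D Y ?_ (fun n => (weylFil K n).map φ) ?_ ?_ ?_ ?_ n
    · refine LinearMap.ext fun q => ?_
      obtain ⟨a, rfl⟩ := hsurj q
      have := congrArg (fun b => π (b * a)) (derOp_mul_xOp (K := K))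
      simp only [add_mul, one_mul, map_add, mul_assoc] at this
      simp [hD, hY, this]
    · exact fun n => Submodule.map_mono (weylFil_mono n.le_succ)
    · rintro n _ ⟨a, ha, rfl⟩
      exact ⟨derOp K * a, derOp_mul_mem_weylFil ha, by simp [hφ, hD, mul_assoc]⟩
    · rintro n _ ⟨a, ha, rfl⟩
      exact ⟨xOp K * a, xOp_mul_mem_weylFil ha, by simp [hφ, hY, mul_assoc]⟩
    · rw [Submodule.ne_bot_iff]
      refine ⟨φ 1, ⟨1, one_mem_weylFil 0, rfl⟩, ?_⟩
      rw [← hπ] at hvP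
      simpa [hφ] using hvP
  set W : Submodule K (Module.End K K[X]) := Q ⊓ weylFil K (n + m)
  have : FiniteDimensional K W := Submodule.finiteDimensional_of_le inf_le_right
  have hle : (weylFil K n).map φ ≤ W.map π := by
    rintro _ ⟨a, ha, rfl⟩
    exact ⟨a * v, ⟨hQ a (weylFil_le_I1 ha) v hvQ, mul_mem_weylFil ha hvm⟩, rfl⟩
  have hrank := LinearMap.finrank_range_add_finrank_ker (V := W) (V₂ := M) (π.domRestrict W)
  rw [LinearMap.range_domRestrict] at hrank
  have hker : (LinearMap.ker (π.domRestrict W)).map W.subtype = P ⊓ weylFil K (n + m) := by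
    rw [LinearMap.ker_domRestrict, hπ, Submodule.map_comap_subtype,
      inf_right_comm, inf_of_le_right hPQ]
  rw [← Submodule.finrank_map_subtype_eq, hker] at hrank
  have := Submodule.finrank_mono hle
  omega

lemma finrank_inf_weylFil_add_le {P Q : Submodule K (Module.End K K[X])} (hPQ : P ≤ Q)
    (hxP : ∀ a ∈ P, xOp K * a ∈ P) (hdP : ∀ a ∈ P, derOp K * a ∈ P)
    (hQ : ∀ r ∈ I1 K, ∀ a ∈ Q, r * a ∈ Q)
    {m : ℕ} {v : Module.End K K[X]} (hvm : v ∈ weylFil K m) (hvQ : v ∈ Q) (hvP : v ∉ P) (n : ℕ) :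
    Module.finrank K (P ⊓ weylFil K (n + m) : Submodule K (Module.End K K[X])) + (n + 1) ≤
      Module.finrank K (Q ⊓ weylFil K (n + m) : Submodule K (Module.End K K[X])) :=
  finrank_inf_weylFil_add_le_aux hPQ P.mkQ P.ker_mkQ P.mkQ_surjective
    (P.mapQ P (LinearMap.mulLeft K (derOp K)) hdP) (P.mapQ P (LinearMap.mulLeft K (xOp K)) hxP)
    (fun _ => rfl) (fun _ => rfl) hQ hvm hvQ hvP n

variable (K) in
/-- A left ideal of `I₁` viewed as a subspace of `End_K(K[x])`. -/
def toEnd (L : Ideal (I1 K)) : Submodule K (Module.End K K[X]) :=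
  (L.restrictScalars K).map (I1 K).val.toLinearMap

lemma mem_toEnd {L : Ideal (I1 K)} {a : Module.End K K[X]} :
    a ∈ toEnd K L ↔ ∃ h : a ∈ I1 K, (⟨a, h⟩ : I1 K) ∈ L := by
  constructor
  · rintro ⟨a, ha, rfl⟩
    exact ⟨a.2, ha⟩
  · rintro ⟨h, ha⟩
    exact ⟨_, ha, rfl⟩

lemma mul_mem_toEnd {L : Ideal (I1 K)} {r a : Module.End K K[X]} (hr : r ∈ I1 K)
    (ha : a ∈ toEnd K L) : r * a ∈ toEnd K L := by
  obtain ⟨h, ha⟩ := mem_toEnd.1 ha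
  exact mem_toEnd.2 ⟨mul_mem hr h, L.mul_mem_left ⟨r, hr⟩ ha⟩

lemma toEnd_mono {L L' : Ideal (I1 K)} (h : L ≤ L') : toEnd K L ≤ toEnd K L' :=
  Submodule.map_mono h

variable (K) in
/-- The ideal `F` as a left ideal of `I₁`. -/
def Fideal : Ideal (I1 K) where
  carrier := {a | (a : Module.End K K[X]) ∈ Fset K}
  zero_mem' := (Fset K).zero_mem
  add_mem' := fun ha hb => (Fset K).add_mem ha hb
  smul_mem' := fun c _ ha => mul_mem_Fset (c : Module.End K K[X]) ha

lemma mem_Fideal {a : I1 K} : a ∈ Fideal K ↔ (a : Module.End K K[X]) ∈ Fset K := Iff.rfl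

lemma exists_mem_weylFil_of_lt {L L' : Ideal (I1 K)} (hF : Fideal K ≤ L) (h : L < L') :
    ∃ m, ∃ v ∈ weylFil K m, v ∈ toEnd K L' ∧ v ∉ toEnd K L := by
  obtain ⟨hle, r, hr', hr⟩ := SetLike.lt_iff_le_and_exists.1 h
  obtain ⟨k, m, hk⟩ := exists_derOp_pow_mul_mem_weylFil r.2
  refine ⟨m, _, hk, mul_mem_toEnd (pow_mem (derOp_mem K) k) (mem_toEnd.2 ⟨r.2, hr'⟩),
    fun hv => hr ?_⟩
  have h1 : intOp K ^ k * (derOp K ^ k * r) ∈ toEnd K L :=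
    mul_mem_toEnd (pow_mem (intOp_mem K) k) hv
  have h2 : (1 - intOp K ^ k * derOp K ^ k) * r ∈ Fset K :=
    Fset_mul_mem (one_sub_mem_Fset k) r.2
  have h3 : (1 - intOp K ^ k * derOp K ^ k) * (r : Module.End K K[X]) ∈ toEnd K L :=
    mem_toEnd.2 ⟨Fset_mem_I1 h2, hF h2⟩
  have h4 := add_mem h1 h3
  rw [← mul_assoc, ← add_mul, add_sub_cancel, one_mul] at h4
  obtain ⟨_, h5⟩ := mem_toEnd.1 h4
  exact h5

/-- Chains of left ideals containing `F` and a fixed element of order `d` of the Weyl algebra have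
length at most `d`. -/
lemma not_chain {d : ℕ} {b : Module.End K K[X]} (hb : b ∈ weylFil K d) (hb0 : b ≠ 0)
    (L : ℕ → Ideal (I1 K)) (hF : Fideal K ≤ L 0) (hbL : b ∈ toEnd K (L 0))
    (hL : ∀ i ≤ d, L i < L (i + 1)) : False := by
  have hFi : ∀ i ≤ d, Fideal K ≤ L i := by
    intro i
    induction i with
    | zero => exact fun _ => hF
    | succ i ih => exact fun hi => (ih (by omega)).trans (hL i (by omega)).le
  obtain ⟨m, hdm, hm⟩ : ∃ m, d ≤ m ∧ ∀ i ≤ d, ∃ v ∈ weylFil K m, v ∈ toEnd K (L (i + 1)) ∧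
      v ∉ toEnd K (L i) := by
    have h := fun i : Fin (d + 1) =>
      exists_mem_weylFil_of_lt (hFi i (by omega)) (hL i (by omega))
    choose m v hv hv' using h
    refine ⟨d + ∑ i, m i, by omega, fun i hi =>
      ⟨v ⟨i, by omega⟩, weylFil_mono ?_ (hv _), hv' ⟨i, by omega⟩⟩⟩
    exact (Finset.single_le_sum (fun _ _ => Nat.zero_le _) (Finset.mem_univ _)).trans
      (Nat.le_add_left _ _)
  let n := d * m
  let g := fun i => Module.finrank K
    (toEnd K (L i) ⊓ weylFil K (n + m) : Submodule K (Module.End K K[X]))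
  have hstep : ∀ i ≤ d, g i + (n + 1) ≤ g (i + 1) := by
    intro i hi
    obtain ⟨v, hvm, hv', hv⟩ := hm i hi
    exact finrank_inf_weylFil_add_le (toEnd_mono (hL i hi).le)
      (fun a => mul_mem_toEnd (xOp_mem K)) (fun a => mul_mem_toEnd (derOp_mem K))
      (fun r hr a => mul_mem_toEnd hr) hvm hv' hv n
  have hchain : ∀ i ≤ d + 1, g 0 + i * (n + 1) ≤ g i := by
    intro i
    induction i with
    | zero => simp
    | succ i ih =>
      intro hi
      have h1 := ih (by omega)
      have h2 := hstep i (by omega)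
      rw [add_mul, one_mul]
      omega
  have htop : g (d + 1) ≤ Module.finrank K (weylFil K (n + m)) :=
    Submodule.finrank_mono inf_le_right
  have hbot : Module.finrank K (weylFil K (n + m - d)) ≤ g 0 := by
    have : FiniteDimensional K
        (toEnd K (L 0) ⊓ weylFil K (n + m) : Submodule K (Module.End K K[X])) :=
      Submodule.finiteDimensional_of_le inf_le_right
    let f : weylFil K (n + m - d) →ₗ[K]
        (toEnd K (L 0) ⊓ weylFil K (n + m) : Submodule K (Module.End K K[X])) :=
      ((LinearMap.mulRight K b).domRestrict _).codRestrict _ fun u =>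
        ⟨mul_mem_toEnd (weylFil_le_I1 u.2) hbL,
          weylFil_mono (by omega) (mul_mem_weylFil u.2 hb)⟩
    refine LinearMap.finrank_le_finrank_of_injective (f := f) ?_
    rw [injective_iff_map_eq_zero]
    intro u hu
    by_contra hu0
    exact weylFil_mul_ne_zero u.2 hb (fun h => hu0 (Subtype.ext h)) hb0 (congrArg Subtype.val hu)
  have hub := finrank_weylFil_add_le (K := K) (n + m - d) d
  rw [Nat.sub_add_cancel (by omega)] at hub
  have := hchain (d + 1) le_rfl
  have h6 : (d + 1) * (n + 1) ≤ d * (n + m + 1) := by omega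
  simp only [n] at h6
  nlinarith

lemma exists_X_pow_dvd_apply {r : Module.End K K[X]} (hr : r ∈ I1 K) :
    ∃ s, ∀ (N : ℕ) (p : K[X]), X ^ (N + s) ∣ p → X ^ N ∣ r p := by
  induction hr using I1_induction with
  | smul c => exact ⟨0, fun N p h => by
    rw [LinearMap.smul_apply, Module.End.one_apply, smul_eq_C_mul]
    exact h.mul_left _⟩
  | x => exact ⟨0, fun N p h => h.mul_left X⟩
  | der =>
    refine ⟨1, fun N p h => ?_⟩
    rw [X_pow_dvd_iff] at h ⊢
    intro d hd
    rw [derOp_apply, coeff_derivative, h _ (by omega), zero_mul]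
  | int =>
    refine ⟨0, fun N p h => ?_⟩
    rw [X_pow_dvd_iff] at h ⊢
    rintro (_ | d) hd
    · exact coeff_intOp_zero p
    · rw [coeff_intOp_succ, h _ (by omega), mul_zero]
  | add a b _ _ ha hb =>
    obtain ⟨s, hs⟩ := ha
    obtain ⟨t, ht⟩ := hb
    refine ⟨s + t, fun N p h => dvd_add (hs N p ?_) (ht N p ?_)⟩ <;>
      exact (pow_dvd_pow X (by omega)).trans h
  | mul a b _ _ ha hb =>
    obtain ⟨s, hs⟩ := ha
    obtain ⟨t, ht⟩ := hb
    exact ⟨s + t, fun N p h => hs N _ (ht _ p (by rwa [add_assoc]))⟩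

lemma one_sub_derOp_surjective : Function.Surjective (1 - derOp K : Module.End K K[X]) := by
  intro q
  refine ⟨(∑ i ∈ Finset.range (q.natDegree + 1), derOp K ^ i) q, ?_⟩
  rw [← Module.End.mul_apply, mul_neg_geom_sum, LinearMap.sub_apply, derOp_pow_apply,
    iterate_derivative_eq_zero (Nat.lt_succ_self _), sub_zero, Module.End.one_apply]

lemma coeff_ne_zero_of_one_sub_derOp_apply {w : K[X]} {N j : ℕ}
    (hw : (1 - derOp K : Module.End K K[X]) w = X ^ N) (hj : j ≤ N) : w.coeff j ≠ 0 := by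
  have hc : ∀ i, w.coeff i - w.coeff (i + 1) * (i + 1) = if i = N then 1 else 0 := by
    intro i
    rw [← coeff_X_pow, ← hw, LinearMap.sub_apply, coeff_sub, derOp_apply, coeff_derivative,
      Module.End.one_apply]
  have hne : ∀ i : ℕ, (i : K) + 1 ≠ 0 := fun i => by exact_mod_cast i.succ_ne_zero
  intro h0
  have hN : ∀ i, j + i ≤ N → w.coeff (j + i) = 0 := by
    intro i
    induction i with
    | zero => exact fun _ => h0
    | succ i ih =>
      intro hi
      have := hc (j + i)
      rw [ih (by omega), if_neg (by omega), zero_sub, neg_eq_zero, mul_eq_zero] at this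
      exact this.resolve_right (hne _)
  have hlarge : ∀ i, w.coeff (N + 1 + i) ≠ 0 := by
    intro i
    induction i with
    | zero =>
      intro h
      have h1 := hc N
      have h2 := hN (N - j) (by omega)
      rw [Nat.add_sub_cancel' hj] at h2
      rw [h2, if_pos rfl, h] at h1
      simp at h1
    | succ i ih =>
      intro h
      have := hc (N + 1 + i)
      rw [add_assoc, add_assoc, add_assoc] at this
      rw [add_assoc, add_comm i] at h
      rw [add_comm i, h, if_neg (by omega), zero_mul, sub_zero] at this
      exact ih (by rwa [add_assoc])
  exact hlarge w.natDegree (coeff_eq_zero_of_natDegree_lt (by omega))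

/-- Elements of the form `cⁿ - r cⁿ⁺¹` with `c = 1 - ∂` do not lie in `F`. -/
lemma pow_sub_mul_pow_notMem_Fset {r : Module.End K K[X]} (hr : r ∈ I1 K) (n : ℕ) :
    (1 - derOp K) ^ n - r * (1 - derOp K) ^ (n + 1) ∉ Fset K := by
  intro hf
  obtain ⟨s, hs⟩ := exists_X_pow_dvd_apply hr
  obtain ⟨j, hj⟩ := exists_coeff_eq_zero_of_mem_Fset hf
  obtain ⟨w, hw⟩ := one_sub_derOp_surjective (K := K) (X ^ (j + 1 + s))
  obtain ⟨p, hp⟩ : ∃ p, ((1 - derOp K) ^ n : Module.End K K[X]) p = w := by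
    rw [Module.End.coe_pow]
    exact one_sub_derOp_surjective.iterate n w
  have h := hj p j le_rfl
  rw [LinearMap.sub_apply, hp, Module.End.mul_apply, pow_succ', Module.End.mul_apply, hp, hw,
    coeff_sub, X_pow_dvd_iff.1 (hs (j + 1) _ dvd_rfl) j (by omega), sub_zero] at h
  exact coeff_ne_zero_of_one_sub_derOp_apply hw (by omega) h

/-- An element of the Weyl algebra commuting with `x` and `∂` is a scalar. -/
lemma exists_eq_smul_one {b : Module.End K K[X]} (hx : b * xOp K = xOp K * b)
    (hd : derOp K * b = b * derOp K) : ∃ c : K, b = c • 1 := by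
  have h1 : ∀ n, b (X ^ n) = X ^ n * b 1 := by
    intro n
    induction n with
    | zero => simp
    | succ n ih =>
      have := LinearMap.congr_fun hx (X ^ n)
      rw [Module.End.mul_apply, Module.End.mul_apply, xOp_apply, xOp_apply, ← pow_succ', ih] at this
      rw [this, pow_succ', mul_assoc]
  have h2 : derivative (b 1) = 0 := by
    have := LinearMap.congr_fun hd 1
    rwa [Module.End.mul_apply, Module.End.mul_apply, derOp_apply, derOp_apply, derivative_one,
      map_zero] at this
  refine ⟨(b 1).coeff 0, end_ext fun n => ?_⟩
  rw [h1, LinearMap.smul_apply, Module.End.one_apply, smul_eq_C_mul, mul_comm,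
    ← eq_C_of_derivative_eq_zero h2]

lemma derOp_pow_mul_ne_zero {a : I1 K} (ha : a ∉ Fideal K) (k : ℕ) :
    derOp K ^ k * (a : Module.End K K[X]) ≠ 0 := by
  intro h
  have := Fset_mul_mem (one_sub_mem_Fset k) a.2
  rw [sub_mul, mul_assoc, h, mul_zero, one_mul, sub_zero] at this
  exact ha this

/-- `I₁/F` is a simple ring. -/
lemma one_mem_of_two_sided {T : Ideal (I1 K)} (hT : ∀ a ∈ T, ∀ r : I1 K, a * r ∈ T)
    {a : I1 K} (ha : a ∈ T) (haF : a ∉ Fideal K) : 1 ∈ T := by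
  have hex : ∃ n, ∃ b ∈ weylFil K n, b ∈ toEnd K T ∧ b ≠ 0 := by
    obtain ⟨k, n, hb⟩ := exists_derOp_pow_mul_mem_weylFil a.2
    exact ⟨n, _, hb, mul_mem_toEnd (pow_mem (derOp_mem K) k) (mem_toEnd.2 ⟨a.2, ha⟩),
      derOp_pow_mul_ne_zero haF k⟩
  classical
  obtain ⟨b, hbn, hbT, hb0⟩ := Nat.find_spec hex
  have hmin := fun m => Nat.find_min hex (m := m)
  have hmul : ∀ r ∈ I1 K, b * r ∈ toEnd K T := fun r hr => by
    obtain ⟨h, hb⟩ := mem_toEnd.1 hbT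
    exact mem_toEnd.2 ⟨mul_mem h hr, hT _ hb ⟨r, hr⟩⟩
  obtain ⟨c, rfl⟩ : ∃ c : K, b = c • 1 := by
    rcases hn : Nat.find hex with _ | n
    · rw [hn] at hbn
      obtain ⟨c, hc⟩ := Submodule.mem_span_singleton.1 <|
        weylFil_map_le (P := Submodule.span K {1}) LinearMap.id (fun i j hij => by
          obtain ⟨rfl, rfl⟩ : i = 0 ∧ j = 0 := by omega
          simp [Submodule.mem_span_singleton_self]) hbn
      exact ⟨c, hc.symm⟩
    · rw [hn] at hbn hmin
      have hmin' : ∀ b ∈ weylFil K n, b ∈ toEnd K T → b = 0 := fun b hb hbT => by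
        by_contra h
        exact hmin n n.lt_succ_self ⟨b, hb, hbT, h⟩
      refine exists_eq_smul_one ?_ ?_
      · exact sub_eq_zero.1 <| hmin' _ (xOp_commutator_mem_weylFil hbn) <|
          sub_mem (hmul _ (xOp_mem K)) (mul_mem_toEnd (xOp_mem K) hbT)
      · exact sub_eq_zero.1 <| hmin' _ (derOp_commutator_mem_weylFil hbn) <|
          sub_mem (mul_mem_toEnd (derOp_mem K) hbT) (hmul _ (derOp_mem K))
  have hc : c ≠ 0 := by rintro rfl; simp at hb0
  have h1 := (toEnd K T).smul_mem c⁻¹ hbT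
  rw [smul_smul, inv_mul_cancel₀ hc, one_smul] at h1
  exact (mem_toEnd.1 h1).2

lemma isNoetherian_pi_of_isSimpleModule (R P ι : Type*) [Ring R] [AddCommGroup P] [Module R P]
    [IsSimpleModule R P] [Finite ι] : IsNoetherian R (ι → P) := inferInstance

lemma isArtinian_pi_of_isSimpleModule (R P ι : Type*) [Ring R] [AddCommGroup P] [Module R P]
    [IsSimpleModule R P] [Finite ι] : IsArtinian R (ι → P) := inferInstance

instance : IsSimpleModule (I1 K) K[X] := by
  refine isSimpleModule_iff_toSpanSingleton_surjective.2 ⟨inferInstance, fun p hp q => ?_⟩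
  obtain ⟨j, hj⟩ : ∃ j, p.coeff j ≠ 0 := by
    by_contra! h
    exact hp (Polynomial.ext h)
  refine ⟨⟨_, Fset_mem_I1 (rankOne_mem_Fset j ((p.coeff j)⁻¹ • q))⟩, ?_⟩
  change p.coeff j • (p.coeff j)⁻¹ • q = q
  rw [smul_smul, mul_inv_cancel₀ hj, one_smul]

variable (K) in
/-- The left ideal of the operators that vanish on `xᵏ` for all `k ≥ N`. -/
def Ftrunc (N : ℕ) : Ideal (I1 K) where
  carrier := {a | ∀ k ≥ N, (a : Module.End K K[X]) (X ^ k) = 0}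
  zero_mem' := fun _ _ => rfl
  add_mem' := fun {a b} ha hb k hk => by
    change (a : Module.End K K[X]) (X ^ k) + (b : Module.End K K[X]) (X ^ k) = 0
    rw [ha k hk, hb k hk, add_zero]
  smul_mem' := fun c a ha k hk => by
    change (c : Module.End K K[X]) ((a : Module.End K K[X]) (X ^ k)) = 0
    rw [ha k hk, map_zero]

variable (K) in
/-- The action of the elements of `Ftrunc K N` on the first `N` monomials. -/
def FtruncHom (N : ℕ) : Ftrunc K N →ₗ[I1 K] Fin N → K[X] where
  toFun a k := (a.1 : Module.End K K[X]) (X ^ (k : ℕ))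
  map_add' _ _ := rfl
  map_smul' _ _ := rfl

lemma FtruncHom_injective (N : ℕ) : Function.Injective (FtruncHom K N) := by
  refine fun a b h => Subtype.ext (Subtype.ext (end_ext fun k => ?_))
  by_cases hk : k < N
  · exact congrFun h ⟨k, hk⟩
  · rw [a.2 k (by omega), b.2 k (by omega)]

lemma isNoetherian_Ftrunc (N : ℕ) : IsNoetherian (I1 K) (Ftrunc K N) :=
  have := isNoetherian_pi_of_isSimpleModule (I1 K) K[X] (Fin N)
  isNoetherian_of_injective _ (FtruncHom_injective N)

lemma isArtinian_Ftrunc (N : ℕ) : IsArtinian (I1 K) (Ftrunc K N) :=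
  have := isArtinian_pi_of_isSimpleModule (I1 K) K[X] (Fin N)
  isArtinian_of_injective _ (FtruncHom_injective N)

lemma rankOne_mem_Ftrunc {j N : ℕ} (h : j < N) (p : K[X]) :
    (⟨_, Fset_mem_I1 (rankOne_mem_Fset j p)⟩ : I1 K) ∈ Ftrunc K N := fun k hk => by
  change (X ^ k : K[X]).coeff j • p = 0
  rw [coeff_X_pow, if_neg (by omega), zero_smul]

lemma exists_le_Ftrunc {I : Ideal (I1 K)} (hI : I.FG) (hF : I ≤ Fideal K) :
    ∃ N, I ≤ Ftrunc K N := by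
  have hmem : ∀ f ∈ Fset K, ∃ N : ℕ, ∀ k ≥ N, f (X ^ k) = 0 := by
    intro f hf
    induction hf using Fset_induction with
    | rank j q => exact ⟨j + 1, rankOne_mem_Ftrunc j.lt_succ_self q⟩
    | zero => exact ⟨0, fun _ _ => rfl⟩
    | add f g _ _ hf hg =>
      obtain ⟨M, hM⟩ := hf
      obtain ⟨N, hN⟩ := hg
      exact ⟨M + N, fun k hk => by
        rw [LinearMap.add_apply, hM k (by omega), hN k (by omega), add_zero]⟩
  obtain ⟨S, rfl⟩ := hI
  choose N hN using fun s : S => hmem _ (hF (Submodule.subset_span s.2))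
  refine ⟨∑ s, N s, Submodule.span_le.2 ?_⟩
  refine fun s hs k hk => hN (⟨s, hs⟩ : S) k (le_trans ?_ hk)
  exact Finset.single_le_sum (f := N) (fun _ _ => Nat.zero_le _) (Finset.mem_univ (⟨s, hs⟩ : S))

lemma rankOne_mul_eq_sum {b : Module.End K K[X]} {m j : ℕ}
    (hb : ∀ n, j < n → (b (X ^ n)).coeff m = 0) (p : K[X]) :
    rankOne K m p * b = ∑ k ∈ Finset.range (j + 1), (b (X ^ k)).coeff m • rankOne K k p := by
  refine end_ext fun n => ?_
  simp only [Module.End.mul_apply, rankOne_apply, LinearMap.sum_apply, LinearMap.smul_apply,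
    coeff_X_pow, ite_smul, one_smul, zero_smul, smul_ite, smul_zero, Finset.sum_ite_eq',
    Finset.mem_range]
  split_ifs with h
  · rfl
  · rw [hb n (by omega), zero_smul]

/-- Modulo a left ideal not contained in `F`, the ideal `F` is generated by finitely many copies
of `K[x]`. -/
lemma exists_Fideal_le_sup {a : I1 K} (ha : a ∉ Fideal K) :
    ∃ N, Fideal K ≤ Submodule.span (I1 K) {a} ⊔ Ftrunc K N := by
  obtain ⟨k, n, hb⟩ := exists_derOp_pow_mul_mem_weylFil a.2
  have hb0 := derOp_pow_mul_ne_zero ha k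
  obtain ⟨t, N, ht, hN⟩ := exists_bot_diagonal hb hb0
  set b := derOp K ^ k * (a : Module.End K K[X]) with hbdef
  refine ⟨N + t.natAbs, ?_⟩
  set L := Submodule.span (I1 K) {a} ⊔ Ftrunc K (N + t.natAbs) with hL
  have hbL : b ∈ toEnd K L := mul_mem_toEnd (pow_mem (derOp_mem K) k) <|
    mem_toEnd.2 ⟨a.2, Submodule.mem_sup_left (Submodule.mem_span_singleton_self a)⟩
  have key : ∀ j p, rankOne K j p ∈ toEnd K L := by
    intro j
    induction j using Nat.strong_induction_on with
    | _ j ih =>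
      intro p
      by_cases hj : j < N + t.natAbs
      · exact mem_toEnd.2 ⟨Fset_mem_I1 (rankOne_mem_Fset j p),
          Submodule.mem_sup_right (rankOne_mem_Ftrunc hj p)⟩
      obtain ⟨m, hm⟩ : ∃ m : ℕ, (m : ℤ) = j + t := ⟨(j + t).toNat, by omega⟩
      have h1 := rankOne_mul_eq_sum (b := b) (m := m) (j := j) (fun n hn => ht n m (by omega)) p
      have h2 := hN j m (by omega) hm
      rw [Finset.sum_range_succ, add_comm, ← sub_eq_iff_eq_add] at h1
      have h3 : (b (X ^ j)).coeff m • rankOne K j p ∈ toEnd K L := by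
        rw [← h1]
        refine sub_mem (mul_mem_toEnd (Fset_mem_I1 (rankOne_mem_Fset m p)) hbL) ?_
        exact sum_mem fun i hi => Submodule.smul_mem _ _ (ih i (Finset.mem_range.1 hi) p)
      exact ((toEnd K L).smul_mem_iff h2).1 h3
  suffices ∀ f ∈ Fset K, f ∈ toEnd K L from fun f hf => (mem_toEnd.1 (this f hf)).2
  intro f hf
  induction hf using Fset_induction with
  | rank j q => exact key j q
  | zero => exact zero_mem _
  | add f g _ _ hf hg => exact add_mem hf hg

section Stafford

variable {R : Type*} [Ring R]

lemma isNoetherian_and_isArtinian_of_chain {M : Type*} [AddCommGroup M] [Module R M] (d : ℕ)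
    (h : ∀ L : ℕ → Submodule R M, ¬ ∀ i ≤ d, L i < L (i + 1)) :
    IsNoetherian R M ∧ IsArtinian R M := by
  constructor
  · refine isNoetherian_iff'.2 ⟨wellFounded_iff_isEmpty_descending_chain.2 ⟨fun ⟨f, hf⟩ => ?_⟩⟩
    exact h f fun i _ => hf i
  · refine ⟨wellFounded_iff_isEmpty_descending_chain.2 ⟨fun ⟨f, hf⟩ => ?_⟩⟩
    refine h (fun i => f (d + 1 - i)) fun i hi => ?_
    have := hf (d + 1 - (i + 1))
    rwa [show d + 1 - (i + 1) + 1 = d + 1 - i by omega] at this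

lemma isNoetherian_and_isArtinian_quotient {A F T : Ideal R} [IsNoetherian R T] [IsArtinian R T]
    (hF : F ≤ A ⊔ T) (d : ℕ)
    (h : ∀ L : ℕ → Ideal R, F ≤ L 0 → A ≤ L 0 → ¬ ∀ i ≤ d, L i < L (i + 1)) :
    IsNoetherian R (R ⧸ A) ∧ IsArtinian R (R ⧸ A) := by
  rw [isNoetherian_iff_submodule_quotient (LinearMap.range (A.mkQ ∘ₗ T.subtype)),
    isArtinian_iff_submodule_quotient (LinearMap.range (A.mkQ ∘ₗ T.subtype))]
  set S := LinearMap.range (A.mkQ ∘ₗ T.subtype)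
  have hsurj : Function.Surjective (S.mkQ ∘ₗ A.mkQ) :=
    S.mkQ_surjective.comp A.mkQ_surjective
  obtain ⟨h1, h2⟩ := isNoetherian_and_isArtinian_of_chain (R := R) (M := (R ⧸ A) ⧸ S) d
    fun L hL => by
      have hA : A ≤ (L 0).comap (S.mkQ ∘ₗ A.mkQ) := fun a ha => by
        have : (S.mkQ ∘ₗ A.mkQ) a = 0 := by
          rw [LinearMap.comp_apply, Submodule.mkQ_apply A, (Submodule.Quotient.mk_eq_zero A).2 ha,
            map_zero]
        rw [Submodule.mem_comap, this]
        exact zero_mem _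
      have hT : T ≤ (L 0).comap (S.mkQ ∘ₗ A.mkQ) := fun a ha => by
        have : (S.mkQ ∘ₗ A.mkQ) a = 0 :=
          (Submodule.Quotient.mk_eq_zero S).2 ⟨⟨a, ha⟩, rfl⟩
        rw [Submodule.mem_comap, this]
        exact zero_mem _
      refine h (fun i => (L i).comap (S.mkQ ∘ₗ A.mkQ)) (hF.trans (sup_le hA hT)) hA fun i hi => ?_
      exact (Submodule.comap_mono (hL i hi).le).lt_of_ne
        fun heq => (hL i hi).ne (Submodule.comap_injective_of_surjective hsurj heq)
  exact ⟨⟨inferInstance, h1⟩, ⟨inferInstance, h2⟩⟩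

/-- Elements of Artinian modules are annihilated by many elements of the ring. -/
lemma exists_pow_sub_smul_eq_zero {M : Type*} [AddCommGroup M] [Module R M] [IsArtinian R M]
    (c : R) (m : M) : ∃ (r : R) (n : ℕ), (c ^ n - r * c ^ (n + 1)) • m = 0 := by
  let f : ℕ →o (Submodule R M)ᵒᵈ :=
    { toFun := fun n => OrderDual.toDual (Submodule.span R {c ^ n • m})
      monotone' := monotone_nat_of_le_succ fun n => by
        refine Submodule.span_le.2 (Set.singleton_subset_iff.2 ?_)
        rw [pow_succ', mul_smul]
        exact Submodule.smul_mem _ _ (Submodule.mem_span_singleton_self _) }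
  obtain ⟨n, hn⟩ := IsArtinian.monotone_stabilizes f
  have h : c ^ n • m ∈ Submodule.span R {c ^ (n + 1) • m} := by
    have := Submodule.mem_span_singleton_self (R := R) (c ^ n • m)
    exact (congrArg (fun S => c ^ n • m ∈ OrderDual.ofDual S) (hn (n + 1) n.le_succ)).mp this
  obtain ⟨r, hr⟩ := Submodule.mem_span_singleton.1 h
  exact ⟨r, n, by rw [sub_smul, mul_smul, hr, sub_self]⟩

/-- The properties of the left ideal `F` of `I₁` that enter Stafford's argument. -/
structure IsStaffordIdeal (F : Ideal R) : Prop where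
  exists_pow_sub_notMem : ∃ c : R, ∀ (r : R) (n : ℕ), c ^ n - r * c ^ (n + 1) ∉ F
  one_mem : ∀ T : Ideal R, (∀ a ∈ T, ∀ r, a * r ∈ T) → ∀ a ∈ T, a ∉ F → 1 ∈ T
  exists_le_sup : ∀ a ∉ F, ∃ T : Ideal R, IsNoetherian R T ∧ IsArtinian R T ∧
    F ≤ Submodule.span R {a} ⊔ T
  exists_not_chain : ∀ a ∉ F, ∃ d : ℕ, ∀ L : ℕ → Ideal R, F ≤ L 0 → a ∈ L 0 →
    ¬ ∀ i ≤ d, L i < L (i + 1)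
  isNoetherian_and_isArtinian : ∀ I : Ideal R, I.FG → I ≤ F → IsNoetherian R I ∧ IsArtinian R I

/-- Stafford's argument: modules of finite length are cyclic as soon as all their elements are
annihilated by elements outside of an ideal `F` that is maximal among two-sided ideals. -/
lemma IsStaffordIdeal.exists_span_singleton_eq_top {F : Ideal R} (hF : IsStaffordIdeal F)
    {M : Type*} [AddCommGroup M] [Module R M] [IsNoetherian R M] [IsArtinian R M] :
    ∃ m : M, Submodule.span R {m} = ⊤ := by
  suffices ∀ N : Submodule R M, ∃ m, N ⊔ Submodule.span R {m} = ⊤ by simpa using this ⊥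
  intro N
  have : WellFoundedGT (Submodule R M) := isNoetherian_iff'.1 inferInstance
  induction N using WellFoundedGT.induction with
  | _ N ih =>
    rcases eq_or_ne N ⊤ with rfl | hN
    · exact ⟨0, top_sup_eq _⟩
    obtain ⟨N', hcov, -⟩ := exists_covBy_le_of_lt hN.lt_top
    obtain ⟨m, hm⟩ := ih N' hcov.lt
    obtain ⟨c, hc⟩ := hF.exists_pow_sub_notMem
    obtain ⟨a, haF, ham⟩ : ∃ a ∉ F, a • m ∈ N := by
      obtain ⟨r, n, hrn⟩ := exists_pow_sub_smul_eq_zero c (Submodule.Quotient.mk (p := N) m)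
      exact ⟨_, hc r n, (Submodule.Quotient.mk_eq_zero N).1 hrn⟩
    obtain ⟨s, hs, has⟩ : ∃ s ∈ N', a • s ∉ N := by
      by_contra! hcon
      let T : Ideal R :=
        { carrier := {t | ∀ s ∈ N', t • s ∈ N}
          zero_mem' := fun s _ => by simp
          add_mem' := fun ht hu s hs => by rw [add_smul]; exact add_mem (ht s hs) (hu s hs)
          smul_mem' := fun c t ht s hs => by
            rw [smul_eq_mul, mul_smul]; exact N.smul_mem c (ht s hs) }
      have h1 : 1 ∈ T := hF.one_mem T (fun t ht r s hs => by
        rw [mul_smul]; exact ht _ (N'.smul_mem r hs)) a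
        (show a ∈ T from hcon) haF
      exact hcov.lt.not_ge fun s hs => by simpa using h1 s hs
    refine ⟨m + s, ?_⟩
    have hsub : a • s ∈ N ⊔ Submodule.span R {m + s} := by
      have h1 : a • (m + s) ∈ N ⊔ Submodule.span R {m + s} :=
        Submodule.mem_sup_right (Submodule.smul_mem _ _ (Submodule.mem_span_singleton_self _))
      rw [smul_add] at h1
      exact (Submodule.add_mem_iff_right _ (Submodule.mem_sup_left ham)).1 h1
    have hinf : N' ⊓ (N ⊔ Submodule.span R {m + s}) = N' := by
      refine (hcov.eq_or_eq (le_inf hcov.le le_sup_left) inf_le_left).resolve_left fun h => ?_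
      exact has (h.le ⟨N'.smul_mem a hs, hsub⟩)
    have hle : N' ≤ N ⊔ Submodule.span R {m + s} := inf_eq_left.1 hinf
    rw [eq_top_iff, ← hm]
    refine sup_le hle ((Submodule.span_singleton_le_iff_mem _ _).2 ?_)
    have : m + s ∈ N ⊔ Submodule.span R {m + s} :=
      Submodule.mem_sup_right (Submodule.mem_span_singleton_self _)
    exact (Submodule.add_mem_iff_left _ (hle hs)).1 this

lemma exists_eq_span_pair {I : Ideal R} {a : R} (ha : a ∈ I)
    (h : ∃ m : Submodule.map (Submodule.mkQ (Submodule.span R {a})) I,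
      Submodule.span R {m} = ⊤) :
    ∃ b, I = Submodule.span R {a, b} := by
  obtain ⟨⟨_, b, hb, rfl⟩, hm⟩ := h
  refine ⟨b, le_antisymm (fun x hx => ?_) (Submodule.span_le.2 ?_)⟩
  · have := hm.ge (Submodule.mem_top (x := ⟨_, x, hx, rfl⟩))
    obtain ⟨r, hr⟩ := Submodule.mem_span_singleton.1 this
    have h1 : Submodule.mkQ (Submodule.span R {a}) (r • b) = Submodule.mkQ _ x := by
      rw [map_smul]; exact congrArg Subtype.val hr
    have h2 : x - r • b ∈ Submodule.span R {a} := (Submodule.Quotient.eq _).1 h1.symm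
    rw [Submodule.mem_span_pair]
    obtain ⟨s, hs⟩ := Submodule.mem_span_singleton.1 h2
    exact ⟨s, r, by rw [hs, sub_add_cancel]⟩
  · rintro _ (rfl | rfl) <;> assumption

lemma exists_eq_span_singleton {I : Ideal R} (h : ∃ m : I, Submodule.span R {m} = ⊤) :
    ∃ a, I = Submodule.span R {a} := by
  obtain ⟨m, hm⟩ := h
  refine ⟨m, ?_⟩
  have := congrArg (Submodule.map I.subtype) hm
  rw [Submodule.map_span, Set.image_singleton, Submodule.map_subtype_top] at this
  exact this.symm

/-- The left ideal corresponding to a right ideal under an anti-automorphism. -/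
def flipIdeal (e : R ≃+* Rᵐᵒᵖ) (I : Submodule Rᵐᵒᵖ R) : Ideal R where
  carrier := {x | (e x).unop ∈ I}
  zero_mem' := by simp
  add_mem' := fun ha hb => by simpa using add_mem ha hb
  smul_mem' := fun c x hx => by
    simpa [MulOpposite.smul_eq_mul_unop] using I.smul_mem (MulOpposite.op (e c).unop) hx

lemma mem_flipIdeal {e : R ≃+* Rᵐᵒᵖ} {I : Submodule Rᵐᵒᵖ R} {x : R} :
    x ∈ flipIdeal e I ↔ (e x).unop ∈ I := Iff.rfl

lemma symm_op_mem_flipIdeal {e : R ≃+* Rᵐᵒᵖ} {I : Submodule Rᵐᵒᵖ R} {x : R} :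
    e.symm (MulOpposite.op x) ∈ flipIdeal e I ↔ x ∈ I := by
  rw [mem_flipIdeal, e.apply_symm_apply, MulOpposite.unop_op]

lemma flipIdeal_span (e : R ≃+* Rᵐᵒᵖ) (s : Set R) :
    flipIdeal e (Submodule.span Rᵐᵒᵖ s) =
      Submodule.span R ((fun x => e.symm (MulOpposite.op x)) '' s) := by
  refine le_antisymm (fun x hx => ?_) (Submodule.span_le.2 ?_)
  · suffices ∀ y ∈ Submodule.span Rᵐᵒᵖ s, e.symm (MulOpposite.op y) ∈
        Submodule.span R ((fun x => e.symm (MulOpposite.op x)) '' s) by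
      simpa using this _ (mem_flipIdeal.1 hx)
    intro y hy
    induction hy using Submodule.span_induction with
    | mem y hy => exact Submodule.subset_span ⟨y, hy, rfl⟩
    | zero => simp
    | add y z _ _ hy hz => simpa using add_mem hy hz
    | smul c y _ hy =>
      rw [MulOpposite.smul_eq_mul_unop, MulOpposite.op_mul, map_mul]
      exact Ideal.mul_mem_left _ _ hy
  · rintro _ ⟨x, hx, rfl⟩
    exact symm_op_mem_flipIdeal.2 (Submodule.subset_span hx)

lemma flipIdeal_fg (e : R ≃+* Rᵐᵒᵖ) {I : Submodule Rᵐᵒᵖ R} (hI : I.FG) : (flipIdeal e I).FG := by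
  obtain ⟨s, hs, rfl⟩ := Submodule.fg_def.1 hI
  exact Submodule.fg_def.2 ⟨_, hs.image _, (flipIdeal_span e s).symm⟩

lemma flipIdeal_injective (e : R ≃+* Rᵐᵒᵖ) : Function.Injective (flipIdeal e) :=
  fun I J h => SetLike.ext fun x => by
    rw [← symm_op_mem_flipIdeal (e := e), h, symm_op_mem_flipIdeal]

lemma eq_span_of_flipIdeal_eq (e : R ≃+* Rᵐᵒᵖ) {I : Submodule Rᵐᵒᵖ R} {s : Set R}
    (h : flipIdeal e I = Submodule.span R s) :
    I = Submodule.span Rᵐᵒᵖ ((fun x => (e x).unop) '' s) := by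
  refine flipIdeal_injective e ?_
  rw [h, flipIdeal_span, Set.image_image]
  simp

/-- The analogue of Stafford's theorem for left ideals of a ring with a suitable ideal `F`. -/
theorem IsStaffordIdeal.left {F : Ideal R} (hF : IsStaffordIdeal F) :
    (∀ I : Ideal R, I.FG → ∃ a b : R, I = Submodule.span R {a, b}) ∧
      (∀ I : Ideal R, (¬ ∀ x ∈ I, x ∈ F) → ∃ a b : R, I = Submodule.span R {a, b}) ∧
      (∀ I : Ideal R, I.FG → (∀ x ∈ I, x ∈ F) → ∃ a : R, I = Submodule.span R {a}) := by
  have h1 : ∀ I : Ideal R, (¬ ∀ x ∈ I, x ∈ F) → ∃ a b : R, I = Submodule.span R {a, b} := by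
    intro I hI
    obtain ⟨a, ha, haF⟩ : ∃ a ∈ I, a ∉ F := by simpa using hI
    obtain ⟨T, h1, h2, hT⟩ := hF.exists_le_sup a haF
    obtain ⟨d, hd⟩ := hF.exists_not_chain a haF
    obtain ⟨h3, h4⟩ := isNoetherian_and_isArtinian_quotient hT d fun L h5 h6 =>
      hd L h5 (h6 (Submodule.mem_span_singleton_self a))
    exact ⟨a, exists_eq_span_pair ha hF.exists_span_singleton_eq_top⟩
  have h2 : ∀ I : Ideal R, I.FG → (∀ x ∈ I, x ∈ F) → ∃ a : R, I = Submodule.span R {a} := by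
    intro I hI hIF
    obtain ⟨h1, h2⟩ := hF.isNoetherian_and_isArtinian I hI hIF
    exact exists_eq_span_singleton hF.exists_span_singleton_eq_top
  refine ⟨fun I hI => ?_, h1, h2⟩
  by_cases hIF : ∀ x ∈ I, x ∈ F
  · obtain ⟨a, ha⟩ := h2 I hI hIF
    exact ⟨a, a, by rwa [Set.pair_eq_singleton]⟩
  · exact h1 I hIF

/-- The right ideal version of `IsStaffordIdeal.left`, in the presence of an anti-automorphism
preserving `F`. -/
theorem IsStaffordIdeal.right {F : Ideal R} (hF : IsStaffordIdeal F) (e : R ≃+* Rᵐᵒᵖ)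
    (he : ∀ x, (e x).unop ∈ F ↔ x ∈ F) :
    (∀ I : Submodule Rᵐᵒᵖ R, I.FG → ∃ a b : R, I = Submodule.span Rᵐᵒᵖ {a, b}) ∧
      (∀ I : Submodule Rᵐᵒᵖ R, (¬ ∀ x ∈ I, x ∈ F) →
        ∃ a b : R, I = Submodule.span Rᵐᵒᵖ {a, b}) ∧
      (∀ I : Submodule Rᵐᵒᵖ R, I.FG → (∀ x ∈ I, x ∈ F) →
        ∃ a : R, I = Submodule.span Rᵐᵒᵖ {a}) := by
  have hsub : ∀ I : Submodule Rᵐᵒᵖ R, (∀ x ∈ flipIdeal e I, x ∈ F) ↔ ∀ x ∈ I, x ∈ F := by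
    refine fun I => ⟨fun h x hx => ?_, fun h x hx => (he x).1 (h _ hx)⟩
    have := (he _).2 (h _ (symm_op_mem_flipIdeal.2 hx))
    rwa [e.apply_symm_apply, MulOpposite.unop_op] at this
  have hpair : ∀ I : Submodule Rᵐᵒᵖ R, (∃ a b : R, flipIdeal e I = Submodule.span R {a, b}) →
      ∃ a b : R, I = Submodule.span Rᵐᵒᵖ {a, b} := by
    rintro I ⟨a, b, h⟩
    have := eq_span_of_flipIdeal_eq e h
    rw [Set.image_pair] at this
    exact ⟨_, _, this⟩
  obtain ⟨h1, h2, h3⟩ := hF.left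
  refine ⟨fun I hI => hpair I (h1 _ (flipIdeal_fg e hI)),
    fun I hI => hpair I (h2 _ (mt (hsub I).1 hI)), fun I hI hIF => ?_⟩
  obtain ⟨a, h⟩ := h3 _ (flipIdeal_fg e hI) ((hsub I).2 hIF)
  have := eq_span_of_flipIdeal_eq e h
  rw [Set.image_singleton] at this
  exact ⟨_, this⟩

end Stafford

variable (K) in
lemma isStaffordIdeal_Fideal : IsStaffordIdeal (R := I1 K) (Fideal K) where
  exists_pow_sub_notMem := ⟨⟨1 - derOp K, sub_mem (one_mem _) (derOp_mem K)⟩,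
    fun r n => pow_sub_mul_pow_notMem_Fset r.2 n⟩
  one_mem T hT a ha haF := one_mem_of_two_sided hT ha haF
  exists_le_sup a ha := by
    obtain ⟨N, hN⟩ := exists_Fideal_le_sup ha
    exact ⟨Ftrunc K N, isNoetherian_Ftrunc N, isArtinian_Ftrunc N, hN⟩
  exists_not_chain a ha := by
    obtain ⟨k, d, hb⟩ := exists_derOp_pow_mul_mem_weylFil a.2
    refine ⟨d, fun L hF hA hL => not_chain hb (derOp_pow_mul_ne_zero ha k) L hF ?_ hL⟩
    exact mul_mem_toEnd (pow_mem (derOp_mem K) k) (mem_toEnd.2 ⟨a.2, hA⟩)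
  isNoetherian_and_isArtinian I hI hF := by
    obtain ⟨N, hN⟩ := exists_le_Ftrunc hI hF
    have h1 := isNoetherian_Ftrunc (K := K) N
    have h2 := isArtinian_Ftrunc (K := K) N
    exact ⟨isNoetherian_of_le (R := I1 K) hN, isArtinian_of_le (R := I1 K) hN⟩

variable (K) in
/-- The bilinear form on `K[x]` for which the monomials are orthogonal and `xⁿ` has
square `(n!)²`. -/
def factorialForm : LinearMap.BilinForm K K[X] :=
  (Polynomial.basisMonomials K).constr K fun n => ((n.factorial : K) ^ 2) • lcoeff K n

lemma factorialForm_X_pow (n : ℕ) (q : K[X]) :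
    factorialForm K (X ^ n) q = (n.factorial : K) ^ 2 * q.coeff n := by
  have := (Polynomial.basisMonomials K).constr_basis K
    (fun n : ℕ => ((n.factorial : K) ^ 2) • lcoeff K n) n
  rw [coe_basisMonomials] at this
  rw [factorialForm, X_pow_eq_monomial, this]
  rfl

lemma factorialForm_comm (p q : K[X]) : factorialForm K p q = factorialForm K q p := by
  suffices factorialForm K = (factorialForm K).flip from LinearMap.congr_fun₂ this p q
  refine (Polynomial.basisMonomials K).ext fun m => (Polynomial.basisMonomials K).ext fun n => ?_
  rw [LinearMap.BilinForm.flip_apply]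
  simp only [coe_basisMonomials, ← X_pow_eq_monomial, factorialForm_X_pow, coeff_X_pow]
  rcases eq_or_ne m n with rfl | h
  · rfl
  · rw [if_neg h, if_neg h.symm, mul_zero, mul_zero]

lemma eq_of_factorialForm_eq {p q : K[X]} (h : ∀ r, factorialForm K r p = factorialForm K r q) :
    p = q := by
  ext n
  have h1 : (n.factorial : K) ≠ 0 := by exact_mod_cast n.factorial_ne_zero
  have := h (X ^ n)
  rw [factorialForm_X_pow, factorialForm_X_pow] at this
  exact mul_left_cancel₀ (pow_ne_zero 2 h1) this

variable (K) in
/-- `b` is the adjoint of `a` with respect to `factorialForm`. -/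
def IsFactorialAdjoint (a b : Module.End K K[X]) : Prop :=
  (factorialForm K).IsAdjointPair (factorialForm K) a b

lemma IsFactorialAdjoint.symm {a b : Module.End K K[X]} (h : IsFactorialAdjoint K a b) :
    IsFactorialAdjoint K b a := fun p q => by
  rw [factorialForm_comm, ← h, factorialForm_comm]

lemma IsFactorialAdjoint.unique {a b c : Module.End K K[X]} (h : IsFactorialAdjoint K a b)
    (h' : IsFactorialAdjoint K a c) : b = c :=
  LinearMap.ext fun q => eq_of_factorialForm_eq fun p => by rw [← h p q, h' p q]

lemma isFactorialAdjoint_of_coeff {a b : Module.End K K[X]}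
    (h : ∀ n q, factorialForm K (a (X ^ n)) q = (n.factorial : K) ^ 2 * (b q).coeff n) :
    IsFactorialAdjoint K a b := by
  intro p q
  suffices (factorialForm K).flip q ∘ₗ a = (factorialForm K).flip (b q) from
    LinearMap.congr_fun this p
  refine (Polynomial.basisMonomials K).ext fun n => ?_
  rw [LinearMap.comp_apply, LinearMap.BilinForm.flip_apply, LinearMap.BilinForm.flip_apply]
  simp only [coe_basisMonomials, ← X_pow_eq_monomial]
  rw [h, factorialForm_X_pow]

lemma isFactorialAdjoint_derOp : IsFactorialAdjoint K (derOp K) (intOp K) := by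
  refine isFactorialAdjoint_of_coeff fun n q => ?_
  rw [derOp_apply, derivative_X_pow, ← smul_eq_C_mul, map_smul, LinearMap.smul_apply,
    factorialForm_X_pow]
  rcases n with _ | n
  · simp [coeff_intOp_zero]
  · have : (n : K) + 1 ≠ 0 := by exact_mod_cast n.succ_ne_zero
    rw [coeff_intOp_succ, Nat.factorial_succ]
    push_cast
    simp only [smul_eq_mul]
    field_simp

lemma isFactorialAdjoint_xOp :
    IsFactorialAdjoint K (xOp K) (derOp K * (xOp K * derOp K)) := by
  refine isFactorialAdjoint_of_coeff fun n q => ?_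
  rw [xOp_apply, ← pow_succ', factorialForm_X_pow, Module.End.mul_apply, Module.End.mul_apply,
    derOp_apply, derOp_apply, xOp_apply, coeff_derivative, coeff_X_mul, coeff_derivative,
    Nat.factorial_succ]
  push_cast
  ring

lemma exists_isFactorialAdjoint {a : Module.End K K[X]} (ha : a ∈ I1 K) :
    ∃ b ∈ I1 K, IsFactorialAdjoint K a b := by
  induction ha using I1_induction with
  | smul c =>
    exact ⟨_, smul_one_mem_I1 c, (LinearMap.isAdjointPair_one (B := factorialForm K)).smul c⟩
  | x =>
    exact ⟨_, mul_mem (derOp_mem K) (mul_mem (xOp_mem K) (derOp_mem K)), isFactorialAdjoint_xOp⟩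
  | der => exact ⟨_, intOp_mem K, isFactorialAdjoint_derOp⟩
  | int => exact ⟨_, derOp_mem K, isFactorialAdjoint_derOp.symm⟩
  | add a b _ _ ha hb =>
    obtain ⟨a', ha', h⟩ := ha
    obtain ⟨b', hb', h'⟩ := hb
    exact ⟨_, add_mem ha' hb', LinearMap.IsAdjointPair.add h h'⟩
  | mul a b _ _ ha hb =>
    obtain ⟨a', ha', h⟩ := ha
    obtain ⟨b', hb', h'⟩ := hb
    exact ⟨_, mul_mem hb' ha', LinearMap.IsAdjointPair.mul h h'⟩

/-- The adjoint of an element of `I₁` with respect to `factorialForm`. -/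
def adjointI1 (a : I1 K) : I1 K :=
  ⟨(exists_isFactorialAdjoint a.2).choose, (exists_isFactorialAdjoint a.2).choose_spec.1⟩

lemma isFactorialAdjoint_adjointI1 (a : I1 K) :
    IsFactorialAdjoint K (a : Module.End K K[X]) (adjointI1 a : Module.End K K[X]) :=
  (exists_isFactorialAdjoint a.2).choose_spec.2

lemma adjointI1_eq {a b : I1 K}
    (h : IsFactorialAdjoint K (a : Module.End K K[X]) (b : Module.End K K[X])) :
    adjointI1 a = b :=
  Subtype.ext ((isFactorialAdjoint_adjointI1 a).unique h)

lemma adjointI1_adjointI1 (a : I1 K) : adjointI1 (adjointI1 a) = a :=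
  adjointI1_eq (isFactorialAdjoint_adjointI1 a).symm

variable (K) in
/-- The anti-automorphism of `I₁` interchanging `∂` and `∫`. -/
def adjointEquiv : I1 K ≃+* (I1 K)ᵐᵒᵖ where
  toFun a := MulOpposite.op (adjointI1 a)
  invFun a := adjointI1 a.unop
  left_inv := adjointI1_adjointI1
  right_inv a := congrArg MulOpposite.op (adjointI1_adjointI1 a.unop)
  map_add' a b := congrArg MulOpposite.op <| adjointI1_eq <| LinearMap.IsAdjointPair.add
    (isFactorialAdjoint_adjointI1 a) (isFactorialAdjoint_adjointI1 b)
  map_mul' a b := congrArg MulOpposite.op <| adjointI1_eq <| LinearMap.IsAdjointPair.mul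
    (isFactorialAdjoint_adjointI1 a) (isFactorialAdjoint_adjointI1 b)

lemma isFactorialAdjoint_rankOne (i j : ℕ) :
    IsFactorialAdjoint K (rankOne K j (X ^ i))
      (((i.factorial : K) ^ 2 * ((j.factorial : K) ^ 2)⁻¹) • rankOne K i (X ^ j)) := by
  refine isFactorialAdjoint_of_coeff fun n q => ?_
  have h1 : (j.factorial : K) ≠ 0 := by exact_mod_cast j.factorial_ne_zero
  rw [rankOne_apply, map_smul, LinearMap.smul_apply, factorialForm_X_pow, LinearMap.smul_apply,
    rankOne_apply, coeff_smul, coeff_smul, coeff_X_pow, coeff_X_pow]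
  rcases eq_or_ne j n with rfl | h
  · simp
    field_simp
  · simp [h, h.symm]

lemma exists_isFactorialAdjoint_of_mem_Fset {f : Module.End K K[X]} (hf : f ∈ Fset K) :
    ∃ g ∈ Fset K, IsFactorialAdjoint K f g := by
  induction hf using Submodule.span_induction with
  | mem f hf =>
    obtain ⟨i, j, rfl⟩ := hf
    rw [eOp_eq]
    exact ⟨_, Submodule.smul_mem _ _ (Submodule.smul_mem _ _ (rankOne_mem_Fset _ _)),
      LinearMap.IsAdjointPair.smul _ (isFactorialAdjoint_rankOne i j)⟩
  | zero => exact ⟨0, zero_mem _, LinearMap.isAdjointPair_zero⟩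
  | add f g _ _ hf hg =>
    obtain ⟨f', hf', h⟩ := hf
    obtain ⟨g', hg', h'⟩ := hg
    exact ⟨_, add_mem hf' hg', LinearMap.IsAdjointPair.add h h'⟩
  | smul c f _ hf =>
    obtain ⟨f', hf', h⟩ := hf
    exact ⟨_, Submodule.smul_mem _ c hf', LinearMap.IsAdjointPair.smul c h⟩

lemma adjointEquiv_unop_mem_Fideal_iff (a : I1 K) :
    (adjointEquiv K a).unop ∈ Fideal K ↔ a ∈ Fideal K := by
  have h := isFactorialAdjoint_adjointI1 a
  constructor <;> intro ha
  · obtain ⟨g, hg, h'⟩ := exists_isFactorialAdjoint_of_mem_Fset (mem_Fideal.1 ha)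
    exact mem_Fideal.2 (h.symm.unique h' ▸ hg)
  · obtain ⟨g, hg, h'⟩ := exists_isFactorialAdjoint_of_mem_Fset (mem_Fideal.1 ha)
    exact mem_Fideal.2 (h.unique h' ▸ hg)

variable (K)

/-- analogue of Stafford's theorem: (1) every finitely generated left ideal of
`I₁` is generated by two elements; (2a) every left ideal not contained in `F` is generated by
two elements; (2b) every finitely generated left ideal contained in `F` is generated by one
element; and the same for right ideals. -/
theorem statement9 :
    ((∀ I : Ideal (I1 K), I.FG →
        ∃ a b : I1 K, I = Submodule.span (I1 K) {a, b})
      ∧ (∀ I : Ideal (I1 K), (¬ ∀ x ∈ I, (x : Module.End K (Polynomial K)) ∈ Fset K) →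
          ∃ a b : I1 K, I = Submodule.span (I1 K) {a, b})
      ∧ (∀ I : Ideal (I1 K), I.FG → (∀ x ∈ I, (x : Module.End K (Polynomial K)) ∈ Fset K) →
          ∃ a : I1 K, I = Submodule.span (I1 K) {a}))
    ∧ ((∀ I : Submodule ((I1 K)ᵐᵒᵖ) (I1 K), I.FG →
        ∃ a b : I1 K, I = Submodule.span ((I1 K)ᵐᵒᵖ) {a, b})
      ∧ (∀ I : Submodule ((I1 K)ᵐᵒᵖ) (I1 K),
          (¬ ∀ x ∈ I, (x : Module.End K (Polynomial K)) ∈ Fset K) →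
          ∃ a b : I1 K, I = Submodule.span ((I1 K)ᵐᵒᵖ) {a, b})
      ∧ (∀ I : Submodule ((I1 K)ᵐᵒᵖ) (I1 K), I.FG →
          (∀ x ∈ I, (x : Module.End K (Polynomial K)) ∈ Fset K) →
          ∃ a : I1 K, I = Submodule.span ((I1 K)ᵐᵒᵖ) {a})) :=
  ⟨(isStaffordIdeal_Fideal K).left, (isStaffordIdeal_Fideal K).right (adjointEquiv K)
    adjointEquiv_unop_mem_Fideal_iff⟩

end
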